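/- There is no irreducible real representation of $SU(2)$ of dimension $d$ when $d \equiv 2 \pmod 4$. -/

import Mathlib

open Module MeasureTheory

theorem exists_isRoot_of_monic_of_odd {p : Polynomial ℝ} (hp : p.Monic) (hodd : Odd p.natDegree) :
    ∃ x, p.IsRoot x := by
  have hpos : 0 < p.natDegree := hodd.pos
  have lower : ∃ x, p.eval x ≤ 0 := by
    have hdeg : (-(p.comp (-Polynomial.X))).natDegree = p.natDegree := by
      simp [Polynomial.natDegree_comp]
    have hlead : (-(p.comp (-Polynomial.X))).leadingCoeff = 1 := by
      rw [Polynomial.leadingCoeff_neg, Polynomial.leadingCoeff_comp (by simp)]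
      simp [hp.leadingCoeff, hodd.neg_one_pow]
    have h := (-(p.comp (-Polynomial.X))).tendsto_atTop_of_leadingCoeff_nonneg
      (Polynomial.natDegree_pos_iff_degree_pos.mp (hdeg ▸ hpos)) (by rw [hlead]; exact zero_le_one)
    obtain ⟨x, hx⟩ := (h.eventually_ge_atTop 0).exists
    exact ⟨-x, by simpa using hx⟩
  have upper : ∃ x, 0 ≤ p.eval x :=
    ((p.tendsto_atTop_of_leadingCoeff_nonneg (Polynomial.natDegree_pos_iff_degree_pos.mp hpos)
      (by rw [hp.leadingCoeff]; exact zero_le_one)).eventually_ge_atTop 0).exists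
  exact mem_range_of_exists_le_of_exists_ge p.continuous lower upper

theorem exists_eq_smul_of_odd_finrank {W : Type*} [AddCommGroup W] [Module ℝ W]
    [FiniteDimensional ℝ W] (hW : Odd (finrank ℝ W)) (f : W →ₗ[ℝ] W) :
    ∃ μ : ℝ, ∃ w : W, w ≠ 0 ∧ f w = μ • w := by
  obtain ⟨μ, hμ⟩ := exists_isRoot_of_monic_of_odd f.charpoly_monic
    (by rwa [LinearMap.charpoly_natDegree])
  obtain ⟨w, hw⟩ := ((Module.End.hasEigenvalue_iff_isRoot_charpoly f μ).mpr hμ).exists_hasEigenvector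
  exact ⟨μ, w, hw.2, hw.apply_eq_smul⟩

/-- Integral over the disc of squared radius `s` of a function of the first coordinate. -/
theorem integral_disc_comp_fst {F : ℝ → ℝ} (hF : Continuous F) (s : ℝ) :
    ∫ p : ℝ × ℝ, {p : ℝ × ℝ | p.1 ^ 2 + p.2 ^ 2 < s}.indicator (fun p => F p.1) p =
      ∫ r in Set.Ioi 0, ∫ θ in Set.Ioo (-Real.pi) Real.pi,
        {r : ℝ | r ^ 2 < s}.indicator (fun r => r * F (r * Real.cos θ)) r := by
  have key : ∀ p : ℝ × ℝ, p.1 • {p : ℝ × ℝ | p.1 ^ 2 + p.2 ^ 2 < s}.indicator (fun p => F p.1)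
      (polarCoord.symm p) =
      {p : ℝ × ℝ | p.1 ^ 2 < s}.indicator (fun p => p.1 * F (p.1 * Real.cos p.2)) p := by
    intro p
    have h : (p.1 * Real.cos p.2) ^ 2 + (p.1 * Real.sin p.2) ^ 2 = p.1 ^ 2 := by
      rw [mul_pow, mul_pow, ← mul_add, Real.cos_sq_add_sin_sq, mul_one]
    simp [Set.indicator_apply, polarCoord_symm_apply, h]
  rw [← integral_comp_polarCoord_symm]
  simp only [key]
  rw [polarCoord_target, Measure.volume_eq_prod, setIntegral_prod]
  · rfl
  · have hS : MeasurableSet {p : ℝ × ℝ | p.1 ^ 2 < s} :=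
      (isOpen_lt (by fun_prop) continuous_const).measurableSet
    rw [IntegrableOn, integrable_indicator_iff hS, IntegrableOn, Measure.restrict_restrict hS]
    refine IntegrableOn.mono_set (t := Set.Icc 0 (√s) ×ˢ Set.Icc (-Real.pi) Real.pi)
      (ContinuousOn.integrableOn_compact (isCompact_Icc.prod isCompact_Icc)
        (by fun_prop)) ?_
    rintro ⟨r, θ⟩ ⟨hr, hr0, hθ⟩
    exact ⟨⟨le_of_lt hr0, Real.le_sqrt_of_sq_le (le_of_lt hr)⟩, Set.Ioo_subset_Icc_self hθ⟩

theorem integral_disc_one {s : ℝ} (hs : 0 ≤ s) :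
    ∫ p : ℝ × ℝ, {p : ℝ × ℝ | p.1 ^ 2 + p.2 ^ 2 < s}.indicator (fun _ => (1 : ℝ)) p =
      Real.pi * s := by
  rw [integral_disc_comp_fst (F := fun _ => 1) continuous_const]
  have h : ∀ r ∈ Set.Ioi (0 : ℝ), ∫ θ in Set.Ioo (-Real.pi) Real.pi,
        {r : ℝ | r ^ 2 < s}.indicator (fun r => r * 1) r =
        (Set.Ioo 0 (√s)).indicator (fun r => 2 * Real.pi * r) r := by
    intro r hr
    have hr' : 0 < r := hr
    by_cases h : r ^ 2 < s
    · have : r < √s := Real.lt_sqrt_of_sq_lt h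
      simp [h, this, hr', Real.pi_pos.le, two_mul]
    · have : ¬ r < √s := fun h' => h ((Real.lt_sqrt hr'.le).mp h')
      simp [h, this]
  rw [setIntegral_congr_fun measurableSet_Ioi h, setIntegral_indicator measurableSet_Ioo,
    Set.inter_eq_right.mpr Set.Ioo_subset_Ioi_self, ← integral_Ioc_eq_integral_Ioo,
    ← intervalIntegral.integral_of_le (Real.sqrt_nonneg s), intervalIntegral.integral_const_mul,
    integral_id, Real.sq_sqrt hs]
  ring

theorem integral_disc_eq_zero {F : ℝ → ℝ} (hF : Continuous F)
    (h0 : ∀ c, 0 ≤ c → c ≤ 1 → ∫ θ in (-Real.pi)..Real.pi, F (c * Real.cos θ) = 0)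
    {s : ℝ} (hs : s ≤ 1) :
    ∫ p : ℝ × ℝ, {p : ℝ × ℝ | p.1 ^ 2 + p.2 ^ 2 < s}.indicator (fun p => F p.1) p = 0 := by
  rw [integral_disc_comp_fst hF]
  refine setIntegral_eq_zero_of_forall_eq_zero fun r hr => ?_
  have hr' : 0 < r := hr
  by_cases h : r ^ 2 < s
  · have h1 : r ≤ 1 := by nlinarith
    simp only [Set.indicator_apply, Set.mem_ofPred_eq, h, if_true]
    rw [integral_const_mul, ← integral_Ioc_eq_integral_Ioo,
      ← intervalIntegral.integral_of_le (by linarith [Real.pi_pos]), h0 r hr'.le h1, mul_zero]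
  · simp [h]

theorem integral_parabola_eq_zero {F : ℝ → ℝ} (hF : Continuous F)
    (h0 : ∀ c, 0 ≤ c → c ≤ 1 → ∫ θ in (-Real.pi)..Real.pi, F (c * Real.cos θ) = 0)
    {R : ℝ} (hR0 : 0 ≤ R) (hR : R ≤ 1) :
    ∫ x in (-R)..R, F x * (R ^ 2 - x ^ 2) = 0 := by
  let g : (ℝ × ℝ) × ℝ → ℝ :=
    {p : (ℝ × ℝ) × ℝ | p.1.1 ^ 2 + p.1.2 ^ 2 + p.2 ^ 2 < R ^ 2}.indicator (fun p => F p.1.1)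
  have hS : MeasurableSet {p : (ℝ × ℝ) × ℝ | p.1.1 ^ 2 + p.1.2 ^ 2 + p.2 ^ 2 < R ^ 2} :=
    (isOpen_lt (by fun_prop) continuous_const).measurableSet
  have hg : Integrable g := by
    rw [integrable_indicator_iff hS]
    refine IntegrableOn.mono_set
      (t := (Set.Icc (-R) R ×ˢ Set.Icc (-R) R) ×ˢ Set.Icc (-R) R)
      (ContinuousOn.integrableOn_compact ((isCompact_Icc.prod isCompact_Icc).prod isCompact_Icc)
        (by fun_prop)) ?_
    rintro ⟨⟨x, y⟩, z⟩ h
    have h : x ^ 2 + y ^ 2 + z ^ 2 < R ^ 2 := h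
    refine ⟨⟨abs_le.mp (abs_le_of_sq_le_sq ?_ hR0), abs_le.mp (abs_le_of_sq_le_sq ?_ hR0)⟩,
      abs_le.mp (abs_le_of_sq_le_sq ?_ hR0)⟩ <;> nlinarith [sq_nonneg x, sq_nonneg y, sq_nonneg z]
  have hzero : ∫ p, g p = 0 := by
    rw [Measure.volume_eq_prod, integral_prod_symm _ hg]
    refine integral_eq_zero_of_ae (Filter.Eventually.of_forall fun z => ?_)
    rw [Pi.zero_apply, ← integral_disc_eq_zero hF h0 (s := R ^ 2 - z ^ 2)
      (by nlinarith [sq_nonneg z])]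
    refine integral_congr_ae (Filter.Eventually.of_forall fun p => ?_)
    simp only [g, Set.indicator_apply, Set.mem_ofPred_eq, lt_sub_iff_add_lt]
  have hassoc : ∫ p, g p = ∫ q : ℝ × (ℝ × ℝ), g (MeasurableEquiv.prodAssoc.symm q) :=
    (volume_preserving_prodAssoc.symm.integral_comp' g).symm
  have hg' : Integrable fun q : ℝ × (ℝ × ℝ) => g (MeasurableEquiv.prodAssoc.symm q) :=
    volume_preserving_prodAssoc.symm.integrable_comp_of_integrable hg
  rw [hassoc, Measure.volume_eq_prod, integral_prod _ hg'] at hzero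
  have hslice : ∀ x : ℝ, ∫ p : ℝ × ℝ, g (MeasurableEquiv.prodAssoc.symm (x, p)) =
      (Set.Ioo (-R) R).indicator (fun x => Real.pi * (F x * (R ^ 2 - x ^ 2))) x := by
    intro x
    have : ∀ p : ℝ × ℝ, g (MeasurableEquiv.prodAssoc.symm (x, p)) =
        F x * {p : ℝ × ℝ | p.1 ^ 2 + p.2 ^ 2 < R ^ 2 - x ^ 2}.indicator (fun _ => (1 : ℝ)) p := by
      intro p
      have e : MeasurableEquiv.prodAssoc.symm (x, p) = ((x, p.1), p.2) := rfl
      simp only [e, g, Set.indicator_apply, Set.mem_ofPred_eq, lt_sub_iff_add_lt, mul_ite, mul_one,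
        mul_zero]
      congr 1
      simp only [eq_iff_iff]
      constructor <;> intro h <;> linarith
    simp only [this]
    rw [integral_const_mul]
    by_cases hx : x ∈ Set.Ioo (-R) R
    · have h2 : x ^ 2 < R ^ 2 := sq_lt_sq' hx.1 hx.2
      rw [integral_disc_one (by linarith), Set.indicator_of_mem hx]
      ring
    · rw [Set.indicator_of_notMem hx]
      have hx2 : R ^ 2 ≤ x ^ 2 := by
        by_contra! h
        exact hx (abs_lt.mp (abs_lt_of_sq_lt_sq h hR0))
      have : {p : ℝ × ℝ | p.1 ^ 2 + p.2 ^ 2 < R ^ 2 - x ^ 2} = ∅ := by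
        ext p
        simp only [Set.mem_ofPred_eq, Set.mem_empty_iff_false, iff_false, not_lt]
        nlinarith [sq_nonneg p.1, sq_nonneg p.2]
      simp [this]
  simp only [hslice] at hzero
  rw [integral_indicator measurableSet_Ioo, integral_const_mul, ← integral_Ioc_eq_integral_Ioo,
    ← intervalIntegral.integral_of_le (by linarith)] at hzero
  exact (mul_eq_zero.mp hzero).resolve_left Real.pi_ne_zero

theorem hasDerivAt_integral_symm {f : ℝ → ℝ} (hf : Continuous f) (r : ℝ) :
    HasDerivAt (fun r => ∫ x in (-r)..r, f x) (f r + f (-r)) r := by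
  have h1 : ∀ u, HasDerivAt (fun u => ∫ x in (0 : ℝ)..u, f x) (f u) u := fun u =>
    hf.integral_hasStrictDerivAt 0 u |>.hasDerivAt
  have h2 := (h1 r).sub ((h1 (-r)).comp r (hasDerivAt_neg r))
  refine (h2.congr_of_eventuallyEq (Filter.Eventually.of_forall fun u => ?_)).congr_deriv (by ring)
  exact (intervalIntegral.integral_interval_sub_left (hf.intervalIntegrable _ _)
    (hf.intervalIntegrable _ _)).symm

/-- Injectivity of the Funk transform on zonal functions, evaluated at the poles. -/
theorem add_eq_zero_of_integral_circle_eq_zero {F : ℝ → ℝ} (hF : Continuous F)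
    (h0 : ∀ c, 0 ≤ c → c ≤ 1 → ∫ θ in (-Real.pi)..Real.pi, F (c * Real.cos θ) = 0) :
    F 1 + F (-1) = 0 := by
  have hP : ∀ R ∈ Set.Ioo (0 : ℝ) 1,
      R ^ 2 * (∫ x in (-R)..R, F x) - ∫ x in (-R)..R, F x * x ^ 2 = 0 := by
    intro R hR
    rw [← integral_parabola_eq_zero hF h0 hR.1.le hR.2.le, ← intervalIntegral.integral_const_mul,
      ← intervalIntegral.integral_sub]
    · congr 1
      ext x
      ring
    all_goals exact Continuous.intervalIntegrable (by fun_prop) _ _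
  have deriv_zero : ∀ {f : ℝ → ℝ} {f' R : ℝ}, (∀ R ∈ Set.Ioo (0 : ℝ) 1, f R = 0) →
      R ∈ Set.Ioo (0 : ℝ) 1 → HasDerivAt f f' R → f' = 0 := by
    intro f f' R hf hR hd
    refine hd.unique ((hasDerivAt_const R (0 : ℝ)).congr_of_eventuallyEq ?_)
    filter_upwards [isOpen_Ioo.mem_nhds hR] with x hx using hf x hx
  have hA : ∀ R ∈ Set.Ioo (0 : ℝ) 1, ∫ x in (-R)..R, F x = 0 := by
    intro R hR
    have hd := deriv_zero hP hR ((((hasDerivAt_id R).pow 2).mul (hasDerivAt_integral_symm hF R)).sub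
      (hasDerivAt_integral_symm (f := fun x => F x * x ^ 2) (by fun_prop) R))
    have : 2 * R * ∫ x in (-R)..R, F x = 0 := by
      rw [← hd]
      simp
      ring
    exact (mul_eq_zero.mp this).resolve_left (by linarith [hR.1])
  have hF0 : ∀ R ∈ Set.Ioo (0 : ℝ) 1, F R + F (-R) = 0 := fun R hR =>
    deriv_zero hA hR (hasDerivAt_integral_symm hF R)
  have hcl : Set.EqOn (fun R => F R + F (-R)) (fun _ => 0) (closure (Set.Ioo (0 : ℝ) 1)) :=
    Set.EqOn.closure hF0 (by fun_prop) (by fun_prop)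
  rw [closure_Ioo (by norm_num)] at hcl
  exact hcl (by simp : (1 : ℝ) ∈ Set.Icc (0 : ℝ) 1)

theorem four_dvd_finrank_of_anticommute {V : Type*} [AddCommGroup V] [Module ℝ V]
    (I J : Module.End ℝ V) (hI : I * I = -1) (hJ : J * J = -1) (hIJ : J * I = -(I * J)) :
    4 ∣ finrank ℝ V := by
  let q : QuaternionAlgebra.Basis (Module.End ℝ V) (-1 : ℝ) 0 (-1) :=
    { i := I, j := J, k := I * J
      i_mul_i := by simp [hI]
      j_mul_j := by simp [hJ]
      i_mul_j := rfl
      j_mul_i := by simp [hIJ] }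
  let φ : Quaternion ℝ →ₐ[ℝ] Module.End ℝ V := q.liftHom
  let : Module (Quaternion ℝ) V := Module.compHom V φ.toRingHom
  have : IsScalarTower ℝ (Quaternion ℝ) V := ⟨fun r x v => by
    change φ (r • x) v = r • φ x v
    simp⟩
  have h := Module.finrank_mul_finrank ℝ (Quaternion ℝ) V
  rw [Quaternion.finrank_eq_four] at h
  exact ⟨_, h.symm⟩

namespace SpecialUnitaryTwo

instance : IsTopologicalGroup (Matrix.specialUnitaryGroup (Fin 2) ℂ) where
  continuous_inv := by
    refine Continuous.subtype_mk ?_ _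
    exact continuous_subtype_val.star

instance : CompactSpace (Matrix.specialUnitaryGroup (Fin 2) ℂ) := by
  refine isCompact_iff_compactSpace.mp ?_
  have hK : IsCompact (Set.univ.pi fun _ : Fin 2 => Set.univ.pi fun _ : Fin 2 =>
      Metric.closedBall (0 : ℂ) 1) :=
    isCompact_univ_pi fun _ => isCompact_univ_pi fun _ => isCompact_closedBall 0 1
  refine hK.of_isClosed_subset ?_ ?_
  · have : ((Matrix.specialUnitaryGroup (Fin 2) ℂ : Submonoid _) : Set (Matrix (Fin 2) (Fin 2) ℂ)) =
        {A | A * star A = 1} ∩ {A | A.det = 1} := by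
      ext A
      simp [Matrix.mem_specialUnitaryGroup_iff, Matrix.mem_unitaryGroup_iff]
    rw [this]
    exact (isClosed_eq (by fun_prop) continuous_const).inter
      (isClosed_eq (by fun_prop) continuous_const)
  · intro A hA i _ j _
    simpa using entry_norm_bound_of_unitary hA.1 i j

/-- The matrix with first row `(a, b)` in `SU(2)`. -/
def mk (a b : ℂ) (h : a * star a + b * star b = 1) : Matrix.specialUnitaryGroup (Fin 2) ℂ :=
  ⟨!![a, b; -star b, star a], by
    rw [Matrix.mem_specialUnitaryGroup_iff, Matrix.mem_unitaryGroup_iff]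
    refine ⟨?_, ?_⟩
    · ext i j
      fin_cases i <;> fin_cases j <;>
        simp [Matrix.mul_apply, Fin.sum_univ_two, Matrix.star_apply]
      · exact h
      · ring
      · ring
      · rw [mul_comm, add_comm, mul_comm]
        exact h
    · rw [Matrix.det_fin_two_of]
      linear_combination h⟩

theorem exists_eq_mk (g : Matrix.specialUnitaryGroup (Fin 2) ℂ) :
    ∃ a b h, g = mk a b h := by
  have hdet := (Matrix.mem_specialUnitaryGroup_iff.mp g.2).2
  have hinv : g * star g = 1 := by rw [Matrix.star_eq_inv, mul_inv_cancel]
  have hadj : (star g).1 = g.1.adjugate := by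
    have h1 : g.1 * (star g).1 = 1 := congrArg Subtype.val hinv
    have h2 : g.1.adjugate * g.1 = 1 := by rw [Matrix.adjugate_mul, hdet, one_smul]
    rw [← one_mul (star g).1, ← h2, mul_assoc, h1, mul_one]
  rw [Matrix.specialUnitaryGroup.coe_star, Matrix.adjugate_fin_two] at hadj
  have h11 : star (g.1 0 0) = g.1 1 1 := by simpa using congrFun (congrFun hadj 0) 0
  have h01 : star (g.1 0 1) = - g.1 1 0 := by simpa using congrFun (congrFun hadj 1) 0
  rw [Matrix.det_fin_two] at hdet
  refine ⟨g.1 0 0, g.1 0 1, ?_, ?_⟩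
  · rw [h11, h01]
    linear_combination hdet
  · refine Subtype.ext ?_
    change g.1 = !![_, _; _, _]
    rw [h11, h01, neg_neg, ← Matrix.eta_fin_two]

theorem mk_mul_mk {a b c d x y : ℂ} (h h' h'') (hx : a * c - b * star d = x)
    (hy : a * d + b * star c = y) : mk a b h * mk c d h' = mk x y h'' := by
  subst hx hy
  refine Subtype.ext ?_
  change !![_, _; _, _] * !![_, _; _, _] = !![_, _; _, _]
  ext i j
  fin_cases i <;> fin_cases j <;> simp [Matrix.mul_apply, Fin.sum_univ_two] <;> ring

theorem exp_mul_star_exp (θ : ℝ) :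
    Complex.exp (θ * Complex.I) * star (Complex.exp (θ * Complex.I)) = 1 := by
  rw [Complex.star_def, ← Complex.exp_conj, ← Complex.exp_add]
  simp

/-- The diagonal torus. -/
noncomputable def torus (θ : ℝ) : Matrix.specialUnitaryGroup (Fin 2) ℂ :=
  mk (Complex.exp (θ * Complex.I)) 0 (by simpa using exp_mul_star_exp θ)

theorem continuous_mk {X : Type*} [TopologicalSpace X] {a b : X → ℂ} (ha : Continuous a)
    (hb : Continuous b) (h : ∀ x, a x * star (a x) + b x * star (b x) = 1) :
    Continuous fun x => mk (a x) (b x) (h x) := by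
  refine Continuous.subtype_mk (continuous_matrix fun i j => ?_) _
  fin_cases i <;> fin_cases j <;> simp <;> fun_prop

theorem continuous_torus : Continuous torus :=
  continuous_mk (by fun_prop) continuous_const _

theorem mk_congr {a b c d : ℂ} (hac : a = c) (hbd : b = d) (h h') : mk a b h = mk c d h' := by
  subst hac hbd
  rfl

theorem torus_add (θ φ : ℝ) : torus (θ + φ) = torus θ * torus φ := by
  refine (mk_mul_mk _ _ _ ?_ (by simp)).symm
  rw [zero_mul, sub_zero, ← Complex.exp_add]
  push_cast
  ring_nf

theorem mk_one_zero (h) : mk 1 0 h = 1 := by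
  refine Subtype.ext ?_
  change !![_, _; _, _] = _
  ext i j
  fin_cases i <;> fin_cases j <;> simp

theorem torus_zero : torus 0 = 1 :=
  (mk_congr (by simp) rfl _ (by simp)).trans (mk_one_zero (by simp))

theorem torus_neg (θ : ℝ) : torus (-θ) = (torus θ)⁻¹ := by
  rw [eq_inv_iff_mul_eq_one, ← torus_add, neg_add_cancel, torus_zero]

theorem torus_periodic : Function.Periodic torus (2 * Real.pi) := fun θ =>
  mk_congr (by
    push_cast
    rw [add_mul, Complex.exp_periodic]) rfl _ _

theorem inv_mk {a b : ℂ} (h h') : (mk a b h)⁻¹ = mk (star a) (-b) h' := by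
  refine inv_eq_of_mul_eq_one_right ?_
  rw [← mk_one_zero (by simp)]
  exact mk_mul_mk _ _ _ (by simpa using h) (by simp; ring)

/-- Every double coset of the torus is stable under inversion. -/
theorem exists_inv_eq_torus_mul (g : Matrix.specialUnitaryGroup (Fin 2) ℂ) :
    ∃ α β : ℝ, g⁻¹ = torus α * g * torus β := by
  obtain ⟨a, b, h, rfl⟩ := exists_eq_mk g
  have h1 : star a * star (star a) + -b * star (-b) = 1 := by
    rw [star_star, star_neg, neg_mul_neg, mul_comm (star a), h]
  refine ⟨-(Real.pi / 2) - a.arg, Real.pi / 2 - a.arg, ?_⟩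
  rw [inv_mk _ h1, mul_assoc, eq_comm]
  set α : ℝ := -(Real.pi / 2) - a.arg with hα
  set β : ℝ := Real.pi / 2 - a.arg with hβ
  have hμ := exp_mul_star_exp β
  have hstar : star (Complex.exp (β * Complex.I)) = Complex.exp (-(β * Complex.I)) := by
    rw [Complex.star_def, ← Complex.exp_conj]
    simp
  have h2 : (a * Complex.exp (β * Complex.I)) * star (a * Complex.exp (β * Complex.I)) +
      (b * star (Complex.exp (β * Complex.I))) *
        star (b * star (Complex.exp (β * Complex.I))) = 1 := by
    simp only [star_mul, star_star]
    linear_combination (a * star a + b * star b) * hμ + h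
  have h3 : mk a b h * torus β =
      mk (a * Complex.exp (β * Complex.I)) (b * star (Complex.exp (β * Complex.I))) h2 :=
    mk_mul_mk _ _ _ (by simp) (by simp)
  rw [h3]
  refine mk_mul_mk _ _ _ ?_ ?_
  · have ha : star a = ‖a‖ * Complex.exp (-(a.arg * Complex.I)) := by
      conv_lhs => rw [← Complex.norm_mul_exp_arg_mul_I a]
      rw [star_mul', Complex.star_def, Complex.conj_ofReal, ← Complex.exp_conj]
      simp
    rw [ha]
    conv_lhs => rw [← Complex.norm_mul_exp_arg_mul_I a]
    rw [zero_mul, sub_zero, mul_comm, mul_assoc, mul_assoc, ← Complex.exp_add, ← Complex.exp_add,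
      hα, hβ]
    congr 2
    push_cast
    ring
  · rw [hstar, zero_mul, add_zero, mul_comm, mul_assoc, ← Complex.exp_add, hα, hβ]
    have : -(((Real.pi / 2 - a.arg : ℝ) : ℂ) * Complex.I) +
        ((-(Real.pi / 2) - a.arg : ℝ) : ℂ) * Complex.I = -(Real.pi * Complex.I) := by
      push_cast
      ring
    rw [this, Complex.exp_neg, Complex.exp_pi_mul_I]
    simp

/-- Every element is conjugate to the torus element with the same trace. -/
theorem exists_conj_torus {a b : ℂ} (h) :
    ∃ k, mk a b h = k * torus (Real.arccos a.re) * k⁻¹ := by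
  have hnorm : a.re ^ 2 + a.im ^ 2 + (b.re ^ 2 + b.im ^ 2) = 1 := by
    have := congrArg Complex.re h
    simp at this
    linarith
  have hcos : Real.cos (Real.arccos a.re) = a.re :=
    Real.cos_arccos (by nlinarith [sq_nonneg a.im, sq_nonneg b.re, sq_nonneg b.im])
      (by nlinarith [sq_nonneg a.im, sq_nonneg b.re, sq_nonneg b.im])
  have hl1 := exp_mul_star_exp (Real.arccos a.re)
  have hlt : Complex.exp (Real.arccos a.re * Complex.I) +
      star (Complex.exp (Real.arccos a.re * Complex.I)) = a + star a := by
    rw [Complex.star_def, Complex.add_conj, Complex.add_conj,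
      Complex.exp_ofReal_mul_I_re, hcos]
  by_cases h0 : b = 0 ∧ Complex.exp (Real.arccos a.re * Complex.I) = a
  · refine ⟨1, ?_⟩
    rw [one_mul, inv_one, mul_one]
    exact mk_congr h0.2.symm h0.1 _ _
  unfold torus
  set l := Complex.exp (Real.arccos a.re * Complex.I)
  obtain ⟨n, hn0, hn⟩ : ∃ n : ℝ, n ≠ 0 ∧ (n : ℂ) ^ 2 = b * star b + (l - a) * star (l - a) := by
    refine ⟨√(‖b‖ ^ 2 + ‖l - a‖ ^ 2), ?_, ?_⟩
    · refine (Real.sqrt_pos.mpr ?_).ne'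
      by_cases hb : b = 0
      · have : l - a ≠ 0 := fun h' => h0 ⟨hb, sub_eq_zero.mp h'⟩
        positivity
      · positivity
    · rw [← Complex.ofReal_pow, Real.sq_sqrt (by positivity)]
      simp only [Complex.star_def, Complex.mul_conj']
      push_cast
      rfl
  have hnC : (n : ℂ) ≠ 0 := Complex.ofReal_ne_zero.mpr hn0
  have hns : star (n : ℂ) = n := Complex.conj_ofReal n
  have hk : b / n * star (b / n) + -star ((l - a) / n) * star (-star ((l - a) / n)) = 1 := by
    simp only [star_div₀, hns, star_neg, star_star]
    field_simp
    linear_combination -hn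
  refine ⟨mk (b / n) (-star ((l - a) / n)) hk, ?_⟩
  rw [eq_mul_inv_iff_mul_eq]
  have h1 : (b / n * l) * star (b / n * l) +
      (-star ((l - a) / n) * star l) * star (-star ((l - a) / n) * star l) = 1 := by
    simp only [star_mul, star_star]
    linear_combination l * star l * hk + hl1
  refine (mk_mul_mk _ _ h1 ?_ ?_).trans (mk_mul_mk _ _ _ ?_ ?_).symm
  · simp only [star_div₀, hns, star_neg, star_star]
    field_simp
    ring
  · simp only [star_div₀, hns, star_sub]
    field_simp
    linear_combination h - hl1 + star l * hlt
  · simp [l]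
  · simp [l]

theorem torus_pi_comm (g : Matrix.specialUnitaryGroup (Fin 2) ℂ) :
    torus Real.pi * g = g * torus Real.pi := by
  obtain ⟨a, b, h, rfl⟩ := exists_eq_mk g
  have h' : -a * star (-a) + -b * star (-b) = 1 := by simpa using h
  exact (mk_mul_mk _ _ h' (by simp) (by simp)).trans (mk_mul_mk _ _ h' (by simp) (by simp)).symm

/-- The element of `SU(2)` that normalizes the torus and inverts it. -/
noncomputable def weyl : Matrix.specialUnitaryGroup (Fin 2) ℂ := mk 0 1 (by simp)

theorem weyl_mul_weyl : weyl * weyl = torus Real.pi := mk_mul_mk _ _ _ (by simp) (by simp)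

theorem weyl_mul_torus :
    weyl * torus (Real.pi / 2) = torus Real.pi * (torus (Real.pi / 2) * weyl) := by
  rw [← mul_assoc, ← torus_add]
  have h : (0 : ℂ) * star 0 + -Complex.I * star (-Complex.I) = 1 := by simp
  have e : Complex.exp (Real.pi / 2 * Complex.I) = Complex.I := by
    rw [Complex.exp_pi_div_two_mul_I]
  refine (mk_mul_mk _ _ h ?_ ?_).trans (mk_mul_mk _ _ h ?_ ?_).symm
  · simp
  · simp [e]
  · simp
  · push_cast
    rw [add_mul, Complex.exp_add, e, Complex.exp_pi_mul_I]
    simp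

section Representation

variable {V : Type*} [NormedAddCommGroup V] [NormedSpace ℝ V]
  {ρ : Matrix.specialUnitaryGroup (Fin 2) ℂ →* (V →ₗ[ℝ] V)}

theorem continuous_torus_apply (hρ : ∀ v : V, Continuous fun g => ρ g v) (v : V) :
    Continuous fun θ => ρ (torus θ) v :=
  (hρ v).comp continuous_torus

theorem integral_torus_add (ρ : Matrix.specialUnitaryGroup (Fin 2) ℂ →* (V →ₗ[ℝ] V))
    (s : ℝ) (v : V) :
    ∫ θ in (-Real.pi)..Real.pi, ρ (torus (θ + s)) v =
      ∫ θ in (-Real.pi)..Real.pi, ρ (torus θ) v := by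
  have hper : Function.Periodic (fun θ => ρ (torus θ) v) (2 * Real.pi) := fun θ => by
    simp only [torus_periodic θ]
  rw [intervalIntegral.integral_comp_add_right (fun θ => ρ (torus θ) v)]
  convert hper.intervalIntegral_add_eq (-Real.pi + s) (-Real.pi) using 2 <;> ring

theorem torus_fixed_of_two (hρ : ∀ v : V, Continuous fun g => ρ g v) {w : V}
    (hw : ρ (torus 2) w = w) (s : ℝ) : ρ (torus s) w = w := by
  let S : AddSubgroup ℝ :=
    { carrier := {s | ρ (torus s) w = w}
      zero_mem' := by simp [torus_zero]
      add_mem' := fun {a b} ha hb => by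
        change ρ (torus (a + b)) w = w
        rw [torus_add, map_mul, Module.End.mul_apply, hb, ha]
      neg_mem' := fun {a} ha => by
        change ρ (torus (-a)) w = w
        nth_rw 1 [← show ρ (torus a) w = w from ha]
        rw [← Module.End.mul_apply, ← map_mul, ← torus_add, neg_add_cancel, torus_zero, map_one,
          Module.End.one_apply] }
  have hdense : Dense (AddSubgroup.closure {2, 2 * Real.pi} : Set ℝ) := by
    rw [dense_addSubgroupClosure_pair_iff]
    rw [show 2 / (2 * Real.pi) = Real.pi⁻¹ by field_simp]
    exact irrational_pi.inv
  have hle : AddSubgroup.closure {2, 2 * Real.pi} ≤ S := by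
    rw [AddSubgroup.closure_le]
    rintro _ (rfl | rfl)
    · exact hw
    · change ρ (torus (2 * Real.pi)) w = w
      rw [← zero_add (2 * Real.pi), torus_periodic, torus_zero, map_one, Module.End.one_apply]
  have hclosed : IsClosed (S : Set ℝ) :=
    isClosed_eq (continuous_torus_apply hρ w) continuous_const
  exact hclosed.closure_subset_iff.mpr hle (hdense s)

/-- The average of a representation over the torus. -/
noncomputable def torusAverage (hρ : ∀ v : V, Continuous fun g => ρ g v) : V →ₗ[ℝ] V where
  toFun v := (2 * Real.pi)⁻¹ • ∫ θ in (-Real.pi)..Real.pi, ρ (torus θ) v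
  map_add' v w := by
    simp only [map_add]
    rw [intervalIntegral.integral_add
      ((continuous_torus_apply hρ v).intervalIntegrable _ _)
      ((continuous_torus_apply hρ w).intervalIntegrable _ _), smul_add]
  map_smul' r v := by
    simp only [map_smul, intervalIntegral.integral_smul, RingHom.id_apply]
    rw [smul_comm]

theorem torusAverage_apply (hρ : ∀ v : V, Continuous fun g => ρ g v) (v : V) :
    torusAverage hρ v = (2 * Real.pi)⁻¹ • ∫ θ in (-Real.pi)..Real.pi, ρ (torus θ) v := rfl

theorem torusAverage_torus (hρ : ∀ v : V, Continuous fun g => ρ g v) (s : ℝ) (v : V) :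
    torusAverage hρ (ρ (torus s) v) = torusAverage hρ v := by
  rw [torusAverage_apply, torusAverage_apply, ← integral_torus_add ρ s v]
  congr 2
  ext θ
  rw [torus_add, map_mul]
  rfl

variable [FiniteDimensional ℝ V]

theorem map_torusAverage (hρ : ∀ v : V, Continuous fun g => ρ g v) {W : Type*}
    [NormedAddCommGroup W] [NormedSpace ℝ W] [CompleteSpace W] (f : V →ₗ[ℝ] W) (v : V) :
    f (torusAverage hρ v) = (2 * Real.pi)⁻¹ • ∫ θ in (-Real.pi)..Real.pi, f (ρ (torus θ) v) := by
  have : CompleteSpace V := FiniteDimensional.complete ℝ V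
  rw [torusAverage_apply, map_smul]
  congr 1
  exact (f.toContinuousLinearMap.intervalIntegral_comp_comm
    ((continuous_torus_apply hρ v).intervalIntegrable _ _)).symm

theorem torus_torusAverage (hρ : ∀ v : V, Continuous fun g => ρ g v) (s : ℝ) (v : V) :
    ρ (torus s) (torusAverage hρ v) = torusAverage hρ v := by
  have : CompleteSpace V := FiniteDimensional.complete ℝ V
  rw [map_torusAverage, torusAverage_apply, ← integral_torus_add ρ s]
  congr 2
  ext θ
  rw [add_comm, torus_add, map_mul]
  rfl

theorem torusAverage_eq_self (hρ : ∀ v : V, Continuous fun g => ρ g v) {v : V}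
    (hv : ∀ s, ρ (torus s) v = v) : torusAverage hρ v = v := by
  have : CompleteSpace V := FiniteDimensional.complete ℝ V
  have hpi := Real.pi_pos
  simp only [torusAverage_apply, hv, intervalIntegral.integral_const, smul_smul]
  rw [show (2 * Real.pi)⁻¹ * (Real.pi - -Real.pi) = 1 by field_simp; ring, one_smul]

theorem trace_eq_sum (f : V →ₗ[ℝ] V) :
    LinearMap.trace ℝ V f = ∑ i, (finBasis ℝ V).coord i (f (finBasis ℝ V i)) := by
  rw [LinearMap.trace_eq_matrix_trace ℝ (finBasis ℝ V), Matrix.trace]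
  simp [LinearMap.toMatrix_apply]

/-- A representation on which `-1` acts trivially and without nonzero vectors fixed by the torus
vanishes. -/
theorem finrank_eq_zero_of_torusAverage_eq_zero (hρ : ∀ v : V, Continuous fun g => ρ g v)
    (hpi : ρ (torus Real.pi) = 1) (h0 : torusAverage hρ = 0) : finrank ℝ V = 0 := by
  have hχ : Continuous fun g => LinearMap.trace ℝ V (ρ g) := by
    simp only [trace_eq_sum]
    exact continuous_finsetSum _ fun i _ =>
      ((finBasis ℝ V).coord i).continuous_of_finiteDimensional.comp (hρ _)
  have hconj : ∀ {a b : ℂ} (h), LinearMap.trace ℝ V (ρ (mk a b h)) =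
      LinearMap.trace ℝ V (ρ (torus (Real.arccos a.re))) := by
    intro a b h
    obtain ⟨k, hk⟩ := exists_conj_torus h
    rw [hk, map_mul, LinearMap.trace_mul_comm, ← map_mul, inv_mul_cancel_left]
  have key := add_eq_zero_of_integral_circle_eq_zero
    (F := fun x => LinearMap.trace ℝ V (ρ (torus (Real.arccos x))))
    (hχ.comp (continuous_torus.comp Real.continuous_arccos)) ?_
  · simp only [Real.arccos_one, Real.arccos_neg_one, torus_zero, map_one, hpi,
      LinearMap.trace_one] at key
    have : (finrank ℝ V : ℝ) = 0 := by linarith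
    exact_mod_cast this
  · intro c hc0 hc1
    have hc : (c : ℂ) * star (c : ℂ) + (√(1 - c ^ 2) : ℂ) * star (√(1 - c ^ 2) : ℂ) = 1 := by
      simp only [Complex.star_def, Complex.conj_ofReal]
      rw [← Complex.ofReal_mul, ← Complex.ofReal_mul, Real.mul_self_sqrt (by nlinarith),
        ← Complex.ofReal_add]
      norm_num
      ring
    have hc' : ∀ θ : ℝ, LinearMap.trace ℝ V (ρ (torus (Real.arccos (c * Real.cos θ)))) =
        ∑ i, (((finBasis ℝ V).coord i).comp (ρ (mk c (√(1 - c ^ 2)) hc)))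
          (ρ (torus θ) (finBasis ℝ V i)) := by
      intro θ
      have h1 := exp_mul_star_exp θ
      have h2 : (c * Complex.exp (θ * Complex.I)) * star (c * Complex.exp (θ * Complex.I)) +
          (√(1 - c ^ 2) * star (Complex.exp (θ * Complex.I))) *
            star (√(1 - c ^ 2) * star (Complex.exp (θ * Complex.I))) = 1 := by
        simp only [star_mul, star_star]
        linear_combination
          ((c : ℂ) * star (c : ℂ) + (√(1 - c ^ 2) : ℂ) * star (√(1 - c ^ 2) : ℂ)) * h1 + hc
      have h3 : mk c (√(1 - c ^ 2)) hc * torus θ = mk (c * Complex.exp (θ * Complex.I))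
          (√(1 - c ^ 2) * star (Complex.exp (θ * Complex.I))) h2 :=
        mk_mul_mk _ _ _ (by simp) (by simp)
      have h4 := hconj h2
      rw [← h3, Complex.re_ofReal_mul, Complex.exp_ofReal_mul_I_re] at h4
      rw [← h4, trace_eq_sum, map_mul]
      rfl
    simp only [hc']
    rw [intervalIntegral.integral_finsetSum]
    · refine Finset.sum_eq_zero fun i _ => ?_
      have := map_torusAverage hρ
        (((finBasis ℝ V).coord i).comp (ρ (mk c (√(1 - c ^ 2)) hc))) (finBasis ℝ V i)
      rw [h0, LinearMap.zero_apply, map_zero, eq_comm, smul_eq_zero] at this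
      exact this.resolve_left (by positivity)
    · intro i _
      exact ((LinearMap.continuous_of_finiteDimensional _).comp
        (continuous_torus_apply hρ _)).intervalIntegrable _ _

end Representation

section Orthogonal

variable {E : Type*} [NormedAddCommGroup E] [InnerProductSpace ℝ E]
  {ρ : Matrix.specialUnitaryGroup (Fin 2) ℂ →* (E →ₗ[ℝ] E)}

theorem inner_map_left (hinv : ∀ g v w, inner ℝ (ρ g v) (ρ g w) = inner ℝ v w) (g)
    (v w : E) : inner ℝ (ρ g v) w = inner ℝ v (ρ g⁻¹ w) := by
  rw [← hinv g v, ← Module.End.mul_apply (ρ g) (ρ g⁻¹), ← map_mul, mul_inv_cancel, map_one,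
    Module.End.one_apply]

/-- Matrix coefficients between vectors fixed by the torus are symmetric. -/
theorem inner_map_comm (hinv : ∀ g v w, inner ℝ (ρ g v) (ρ g w) = inner ℝ v w) {x y : E}
    (hx : ∀ s, ρ (torus s) x = x) (hy : ∀ s, ρ (torus s) y = y) (g) :
    inner ℝ (ρ g x) y = inner ℝ (ρ g y) x := by
  obtain ⟨α, β, h⟩ := exists_inv_eq_torus_mul g
  rw [inner_map_left hinv, h, map_mul, map_mul, Module.End.mul_apply, Module.End.mul_apply, hy,
    real_inner_comm]
  nth_rw 1 [← hx α]
  rw [hinv]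

variable [FiniteDimensional ℝ E]

theorem inner_torusAverage_left (hρ : ∀ v : E, Continuous fun g => ρ g v) (v w : E) :
    inner ℝ (torusAverage hρ v) w =
      (2 * Real.pi)⁻¹ • ∫ θ in (-Real.pi)..Real.pi, inner ℝ (ρ (torus θ) v) w := by
  have := map_torusAverage hρ (innerₗ E w) v
  simpa only [innerₗ_apply_apply, real_inner_comm] using this

theorem isSymmetric_torusAverage (hρ : ∀ v : E, Continuous fun g => ρ g v)
    (hinv : ∀ g v w, inner ℝ (ρ g v) (ρ g w) = inner ℝ v w) :
    (torusAverage hρ).IsSymmetric := by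
  intro v w
  rw [inner_torusAverage_left, real_inner_comm, inner_torusAverage_left]
  congr 1
  have h : ∀ θ, inner ℝ (ρ (torus θ) v) w = inner ℝ (ρ (torus (-θ)) w) v := fun θ => by
    rw [inner_map_left hinv, torus_neg, real_inner_comm]
  simp only [h]
  rw [intervalIntegral.integral_comp_neg fun θ => inner ℝ (ρ (torus θ) w) v, neg_neg]

/-- The spherical operators of the pair formed by `SU(2)` and its torus. -/
noncomputable def spherical (hρ : ∀ v : E, Continuous fun g => ρ g v)
    (g : Matrix.specialUnitaryGroup (Fin 2) ℂ) : E →ₗ[ℝ] E :=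
  torusAverage hρ * ρ g * torusAverage hρ

theorem isSymmetric_spherical (hρ : ∀ v : E, Continuous fun g => ρ g v)
    (hinv : ∀ g v w, inner ℝ (ρ g v) (ρ g w) = inner ℝ v w) (g) :
    (spherical hρ g).IsSymmetric := by
  intro v w
  have hP := isSymmetric_torusAverage hρ hinv
  simp only [spherical, Module.End.mul_apply]
  rw [hP, ← hP v, inner_map_comm hinv (torus_torusAverage hρ · v) (torus_torusAverage hρ · w),
    real_inner_comm]

theorem inner_spherical_spherical (hρ : ∀ v : E, Continuous fun g => ρ g v)
    (hinv : ∀ g v w, inner ℝ (ρ g v) (ρ g w) = inner ℝ v w) (g h) (v w : E) :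
    inner ℝ (spherical hρ g (spherical hρ h v)) w = (2 * Real.pi)⁻¹ •
      ∫ θ in (-Real.pi)..Real.pi,
        inner ℝ (ρ (g * torus θ * h) (torusAverage hρ v)) (torusAverage hρ w) := by
  have hP := isSymmetric_torusAverage hρ hinv
  simp only [spherical, Module.End.mul_apply]
  rw [hP, inner_map_left hinv,
    torusAverage_eq_self hρ (fun s => torus_torusAverage hρ s _), inner_torusAverage_left]
  simp only [map_mul, Module.End.mul_apply]
  simp only [inner_map_left hinv g]

theorem commute_spherical (hρ : ∀ v : E, Continuous fun g => ρ g v)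
    (hinv : ∀ g v w, inner ℝ (ρ g v) (ρ g w) = inner ℝ v w) (g h) :
    Commute (spherical hρ g) (spherical hρ h) := by
  refine LinearMap.ext fun v => ext_inner_right ℝ fun w => ?_
  simp only [Module.End.mul_apply]
  rw [inner_spherical_spherical hρ hinv]
  simp only [inner_map_comm hinv (torus_torusAverage hρ · v) (torus_torusAverage hρ · w)]
  rw [← inner_spherical_spherical hρ hinv, isSymmetric_spherical hρ hinv g,
    isSymmetric_spherical hρ hinv h, real_inner_comm]

theorem finrank_range_torusAverage (hρ : ∀ v : E, Continuous fun g => ρ g v)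
    (hinv : ∀ g v w, inner ℝ (ρ g v) (ρ g w) = inner ℝ v w)
    (hirr : ∀ U : Submodule ℝ E, (∀ g v, v ∈ U → ρ g v ∈ U) → U = ⊥ ∨ U = ⊤)
    (h0 : torusAverage hρ ≠ 0) : finrank ℝ (LinearMap.range (torusAverage hρ)) = 1 := by
  set P := torusAverage hρ with hPdef
  have hPP : ∀ v, P (P v) = P v := fun v =>
    torusAverage_eq_self hρ fun s => torus_torusAverage hρ s v
  have htop := LinearMap.IsSymmetric.iSup_iInf_eq_top_of_commute (isSymmetric_spherical hρ hinv)
    fun g h _ => commute_spherical hρ hinv g h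
  obtain ⟨χ, hχ⟩ : ∃ χ : Matrix.specialUnitaryGroup (Fin 2) ℂ → ℝ,
      ¬ (⨅ g, Module.End.eigenspace (spherical hρ g) (χ g)) ≤ LinearMap.ker P := by
    by_contra! h
    have := iSup_le h
    rw [htop, top_le_iff, LinearMap.ker_eq_top] at this
    exact h0 this
  obtain ⟨v, hv, hvP⟩ := SetLike.not_le_iff_exists.mp hχ
  rw [Submodule.mem_iInf] at hv
  have hv : ∀ g, P (ρ g (P v)) = χ g • v := fun g => Module.End.mem_eigenspace_iff.mp (hv g)
  have hvP : P v ≠ 0 := hvP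
  have h1 := hv 1
  rw [map_one, Module.End.one_apply, hPP] at h1
  have hspan : Submodule.span ℝ (Set.range fun g => ρ g (P v)) = ⊤ := by
    refine (hirr _ fun g w hw => ?_).resolve_left ?_
    · have hle : Submodule.span ℝ (Set.range fun g => ρ g (P v)) ≤
          (Submodule.span ℝ (Set.range fun g => ρ g (P v))).comap (ρ g) := by
        rw [Submodule.span_le]
        rintro _ ⟨k, rfl⟩
        refine Submodule.subset_span ⟨g * k, ?_⟩
        simp
      exact hle hw
    · intro h
      refine hvP ?_
      rw [← Submodule.mem_bot ℝ, ← h]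
      exact Submodule.subset_span ⟨1, by simp⟩
  have hrange : LinearMap.range P = Submodule.span ℝ {v} := by
    refine le_antisymm ?_ ?_
    · rw [LinearMap.range_eq_map, ← hspan, Submodule.map_span_le]
      rintro _ ⟨g, rfl⟩
      exact hv g ▸ Submodule.smul_mem _ _ (Submodule.mem_span_singleton_self v)
    · rw [Submodule.span_singleton_le_iff_mem]
      have hχ1 : χ 1 ≠ 0 := fun h => hvP (by rw [h1, h, zero_smul])
      exact ⟨(χ 1)⁻¹ • v, by rw [map_smul, h1, inv_smul_smul₀ hχ1]⟩
  rw [hrange, finrank_span_singleton]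
  rintro rfl
  exact hvP (map_zero P)

theorem even_finrank_ker_torusAverage (hρ : ∀ v : E, Continuous fun g => ρ g v)
    (hinv : ∀ g v w, inner ℝ (ρ g v) (ρ g w) = inner ℝ v w) :
    Even (finrank ℝ (LinearMap.ker (torusAverage hρ))) := by
  by_contra hodd
  rw [Nat.not_even_iff_odd] at hodd
  have hmaps : ∀ v ∈ LinearMap.ker (torusAverage hρ),
      ρ (torus 1) v ∈ LinearMap.ker (torusAverage hρ) := fun v hv => by
    rw [LinearMap.mem_ker, torusAverage_torus]
    exact hv
  obtain ⟨μ, ⟨w, hw⟩, hw0, hμ⟩ :=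
    exists_eq_smul_of_odd_finrank hodd ((ρ (torus 1)).restrict hmaps)
  have hμ : ρ (torus 1) w = μ • w := congrArg Subtype.val hμ
  have hw0 : w ≠ 0 := fun h => hw0 (Subtype.ext h)
  have hμ2 : μ * μ = 1 := by
    have h := hinv (torus 1) w w
    rw [hμ, real_inner_smul_left, real_inner_smul_right, ← mul_assoc] at h
    exact mul_eq_right₀ (inner_self_ne_zero.mpr hw0) |>.mp h
  have hfix : ρ (torus 2) w = w := by
    rw [show torus 2 = torus (1 + 1) by norm_num, torus_add, map_mul, Module.End.mul_apply, hμ, map_smul, hμ, smul_smul,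
      hμ2, one_smul]
  have := torusAverage_eq_self hρ (torus_fixed_of_two hρ hfix)
  exact hw0 (this.symm.trans hw)

theorem finrank_mod_four_ne_two_of_orthogonal (hρ : ∀ v : E, Continuous fun g => ρ g v)
    (hinv : ∀ g v w, inner ℝ (ρ g v) (ρ g w) = inner ℝ v w)
    (hirr : ∀ U : Submodule ℝ E, (∀ g v, v ∈ U → ρ g v ∈ U) → U = ⊥ ∨ U = ⊤) :
    finrank ℝ E % 4 ≠ 2 := by
  intro hd
  set z := ρ (torus Real.pi) with hz
  have hzz : z * z = 1 := by
    rw [hz, ← map_mul, ← torus_add, ← zero_add (Real.pi + Real.pi), ← two_mul, torus_periodic,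
      torus_zero, map_one]
  rcases hirr (LinearMap.ker (z - 1)) (fun g v hv => by
    rw [LinearMap.mem_ker, LinearMap.sub_apply, Module.End.one_apply, sub_eq_zero] at hv ⊢
    rw [hz, ← Module.End.mul_apply, ← map_mul, torus_pi_comm, map_mul, Module.End.mul_apply, ← hz,
      hv]) with h | h
  · have hz1 : z = -1 := by
      refine LinearMap.ext fun v => ?_
      have : z v + v ∈ LinearMap.ker (z - 1) := by
        rw [LinearMap.mem_ker, LinearMap.sub_apply, Module.End.one_apply, map_add,
          ← Module.End.mul_apply z z, hzz, Module.End.one_apply]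
        abel
      rw [h, Submodule.mem_bot] at this
      exact eq_neg_of_add_eq_zero_left this
    have h4 := four_dvd_finrank_of_anticommute (ρ (torus (Real.pi / 2))) (ρ weyl)
      (by rw [← map_mul, ← torus_add, add_halves, ← hz1])
      (by rw [← map_mul, weyl_mul_weyl, ← hz1])
      (by rw [← map_mul, weyl_mul_torus, map_mul, ← hz, hz1, map_mul, neg_one_mul])
    omega
  · have hz1 : z = 1 := sub_eq_zero.mp (LinearMap.ker_eq_top.mp h)
    by_cases h0 : torusAverage hρ = 0
    · have := finrank_eq_zero_of_torusAverage_eq_zero hρ hz1 h0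
      omega
    · have h1 := finrank_range_torusAverage hρ hinv hirr h0
      have h2 := even_finrank_ker_torusAverage hρ hinv
      have h3 := LinearMap.finrank_range_add_finrank_ker (torusAverage hρ)
      rw [Nat.even_iff] at h2
      omega

end Orthogonal

theorem finrank_mod_four_ne_two_of_core {V : Type*} [AddCommGroup V] [Module ℝ V]
    [FiniteDimensional ℝ V] {ρ : Matrix.specialUnitaryGroup (Fin 2) ℂ →* (V →ₗ[ℝ] V)}
    (c : InnerProductSpace.Core ℝ V) (hinv : ∀ g v w, c.inner (ρ g v) (ρ g w) = c.inner v w)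
    (hρ : ∀ (f : V →ₗ[ℝ] ℝ) (v : V), Continuous fun g => f (ρ g v))
    (hirr : ∀ U : Submodule ℝ V, (∀ g v, v ∈ U → ρ g v ∈ U) → U = ⊥ ∨ U = ⊤) :
    finrank ℝ V % 4 ≠ 2 := by
  let : NormedAddCommGroup V := c.toNormedAddCommGroup
  let : InnerProductSpace ℝ V := InnerProductSpace.ofCore c.toCore
  refine finrank_mod_four_ne_two_of_orthogonal (ρ := ρ) (fun v => ?_) hinv hirr
  refine (continuous_finsetSum Finset.univ fun i _ =>
    (hρ ((finBasis ℝ V).coord i) v).smul (continuous_const (y := finBasis ℝ V i))).congr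
    fun g => ?_
  exact (finBasis ℝ V).sum_repr (ρ g v)

/-- Weyl's unitarian trick: a representation of a compact group has an invariant inner product. -/
theorem exists_invariant_core {V : Type*} [NormedAddCommGroup V] [NormedSpace ℝ V]
    [FiniteDimensional ℝ V] {G : Type*} [Group G] [TopologicalSpace G] [IsTopologicalGroup G]
    [CompactSpace G] {ρ : G →* (V →ₗ[ℝ] V)} (hρ : ∀ v : V, Continuous fun g => ρ g v) :
    ∃ c : InnerProductSpace.Core ℝ V, ∀ g v w, c.inner (ρ g v) (ρ g w) = c.inner v w := by
  let : MeasurableSpace G := borel G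
  have : BorelSpace G := ⟨rfl⟩
  let B : V → V → G → ℝ := fun v w g =>
    ∑ i, (finBasis ℝ V).coord i (ρ g⁻¹ v) * (finBasis ℝ V).coord i (ρ g⁻¹ w)
  have hB : ∀ v w, Continuous (B v w) := fun v w =>
    continuous_finsetSum _ fun i _ =>
      (((finBasis ℝ V).coord i).continuous_of_finiteDimensional.comp
        ((hρ v).comp continuous_inv)).mul
      (((finBasis ℝ V).coord i).continuous_of_finiteDimensional.comp
        ((hρ w).comp continuous_inv))
  have hint : ∀ v w, Integrable (B v w) (Measure.haar : Measure G) := fun v w =>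
    (hB v w).integrable_of_hasCompactSupport (HasCompactSupport.of_compactSpace _)
  have hnn : ∀ v g, 0 ≤ B v v g := fun v g => Finset.sum_nonneg fun i _ => mul_self_nonneg _
  refine ⟨{ inner := fun v w => ∫ g, B v w g ∂Measure.haar
            conj_inner_symm := fun v w => ?_
            re_inner_nonneg := fun v => integral_nonneg (hnn v)
            add_left := fun v w x => ?_
            smul_left := fun v w r => ?_
            definite := fun v hv => ?_ }, fun h v w => ?_⟩
  · simp only [B, mul_comm, conj_trivial]
  · rw [← integral_add (hint _ _) (hint _ _)]
    simp only [B, map_add, add_mul, Finset.sum_add_distrib]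
  · simp only [conj_trivial]
    rw [← integral_const_mul]
    simp only [B, map_smul, smul_eq_mul, mul_assoc, Finset.mul_sum]
  · have h1 : B v v 1 = 0 := by
      by_contra h
      exact ((hB v v).integral_pos_of_hasCompactSupport_nonneg_nonzero
        (HasCompactSupport.of_compactSpace _) (hnn v) h).ne' hv
    simp only [B, inv_one, map_one, Module.End.one_apply] at h1
    rw [Finset.sum_eq_zero_iff_of_nonneg fun i _ => mul_self_nonneg _] at h1
    refine (finBasis ℝ V).ext_elem fun i => ?_
    simpa using h1 i (Finset.mem_univ i)
  · change ∫ g, B (ρ h v) (ρ h w) g ∂Measure.haar = ∫ g, B v w g ∂Measure.haar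
    rw [← integral_mul_left_eq_self (B v w) h⁻¹]
    simp only [B, mul_inv_rev, inv_inv, map_mul, Module.End.mul_apply]

end SpecialUnitaryTwo

/-- There is no (continuous, finite-dimensional) irreducible
real representation of `SU(2)` of dimension `d` when `d ≡ 2 (mod 4)`. -/
theorem stmt12 (d : ℕ) (hd2 : d % 4 = 2)
    (V : Type) [NormedAddCommGroup V] [NormedSpace ℝ V]
    [FiniteDimensional ℝ V] (hd : finrank ℝ V = d)
    (ρ : Matrix.specialUnitaryGroup (Fin 2) ℂ →* (V →ₗ[ℝ] V))
    (hcont : ∀ v : V, Continuous fun g => ρ g v)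
    (hirr : ∀ U : Submodule ℝ V, (∀ g v, v ∈ U → ρ g v ∈ U) → U = ⊥ ∨ U = ⊤) :
    False := by
  obtain ⟨c, hc⟩ := SpecialUnitaryTwo.exists_invariant_core hcont
  exact SpecialUnitaryTwo.finrank_mod_four_ne_two_of_core c hc
    (fun f v => f.continuous_of_finiteDimensional.comp (hcont v)) hirr (hd ▸ hd2)
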